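/- arXiv:math/0507473 — 5 statements merged into one kernel-verified Lean document; each statement's English description precedes it below -/
import Mathlib

section
/- Let n ∈ ℕ, let c : Fin n → Fin n → Fin n → ℝ be skew-symmetric in its two lower indices, and let U : Matrix (Fin n) (Fin n) ℝ be orthogonal (Uᵀ * U = 1). Then R²(T_Λ(U)c) = T_S(U)(R²(c)), i.e. for all j, k: R²(T_Λ(U)c) j k = Σ_{p,q} U p j · U q k · R²(c) p q. -/
open Matrix BigOperators

noncomputable section

/-- First piece of the Ricci tensor: `R¹(c) j k = -(1/2) Σ_{s,m} c s m j * c m s k`. -/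
def R1 {n : ℕ} (c : Fin n → Fin n → Fin n → ℝ) (j k : Fin n) : ℝ :=
  -(1/2) * ∑ s, ∑ m, c s m j * c m s k

/-- Second piece: `R²(c) j k = (1/2) Σ_{s,m} c m m s * (c k s j + c j s k)`. -/
def R2 {n : ℕ} (c : Fin n → Fin n → Fin n → ℝ) (j k : Fin n) : ℝ :=
  (1/2) * ∑ s, ∑ m, c m m s * (c k s j + c j s k)

/-- Third piece: `R³(c) j k = (1/4) Σ_{s,m} c j s m * c k s m`. -/
def R3 {n : ℕ} (c : Fin n → Fin n → Fin n → ℝ) (j k : Fin n) : ℝ :=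
  (1/4) * ∑ s, ∑ m, c j s m * c k s m

/-- Fourth piece: `R⁴(c) j k = -(1/2) Σ_{s,m} c m s j * c m s k`. -/
def R4 {n : ℕ} (c : Fin n → Fin n → Fin n → ℝ) (j k : Fin n) : ℝ :=
  -(1/2) * ∑ s, ∑ m, c m s j * c m s k

/-- The Ricci matrix `R(c) = R¹(c) + R²(c) + R³(c) + R⁴(c)`. -/
def Rtot {n : ℕ} (c : Fin n → Fin n → Fin n → ℝ) : Matrix (Fin n) (Fin n) ℝ :=
  Matrix.of fun j k => R1 c j k + R2 c j k + R3 c j k + R4 c j k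

/-- The action of `GL(n)` on structure constants:
`(T_Λ(Q)c) k i j = Σ_{s,m,l} Q s i * Q m j * c l s m * (Q⁻¹) k l`. -/
def TLam {n : ℕ} (Q : Matrix (Fin n) (Fin n) ℝ) (c : Fin n → Fin n → Fin n → ℝ) :
    Fin n → Fin n → Fin n → ℝ :=
  fun k i j => ∑ s, ∑ m, ∑ l, Q s i * Q m j * c l s m * Q⁻¹ k l

/-- The action of `GL(n)` on symmetric matrices:
`(T_S(Q)A) i j = Σ_{p,q} Q p i * Q q j * A p q`. -/
def TS {n : ℕ} (Q A : Matrix (Fin n) (Fin n) ℝ) : Matrix (Fin n) (Fin n) ℝ :=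
  Matrix.of fun i j => ∑ p, ∑ q, Q p i * Q q j * A p q

/-- Entrywise derivative of a curve of matrices. -/
def mderiv {n : ℕ} (Q : ℝ → Matrix (Fin n) (Fin n) ℝ) (t : ℝ) :
    Matrix (Fin n) (Fin n) ℝ :=
  Matrix.of fun i j => deriv (fun s => Q s i j) t

/-- The trace covector `j ↦ Σ_k c k k j` transforms covariantly under an invertible change of
frame. -/
theorem sum_TLam_diag {n : ℕ} (c : Fin n → Fin n → Fin n → ℝ)
    {Q : Matrix (Fin n) (Fin n) ℝ} (hQ : Q * Q⁻¹ = 1) (j : Fin n) :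
    ∑ k, TLam Q c k k j = ∑ m, Q m j * ∑ l, c l l m := by
  calc ∑ k, TLam Q c k k j
      = ∑ m, Q m j * ∑ s, ∑ l, (Q * Q⁻¹) s l * c l s m := by
        simp only [TLam, Matrix.mul_apply, Finset.mul_sum, Finset.sum_mul]
        rw [Finset.sum_comm, Finset.sum_congr rfl fun _ _ => Finset.sum_comm, Finset.sum_comm]
        refine Finset.sum_congr rfl fun m _ => Finset.sum_congr rfl fun s _ => ?_
        rw [Finset.sum_comm]
        exact Finset.sum_congr rfl fun l _ => Finset.sum_congr rfl fun k _ => by ring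
    _ = ∑ m, Q m j * ∑ l, c l l m := by
        simp [hQ, Matrix.one_apply]

/-- Contracting the first lower index of `TLam U c` with a row of an orthogonal matrix `U` undoes
the change of frame in that index. -/
theorem sum_mul_TLam {n : ℕ} (c : Fin n → Fin n → Fin n → ℝ)
    {U : Matrix (Fin n) (Fin n) ℝ} (hU : U * Uᵀ = 1) (b j k : Fin n) :
    ∑ s, U b s * TLam U c k s j = ∑ p, ∑ q, U p j * U q k * c q b p := by
  have hinv : U⁻¹ = Uᵀ := Matrix.inv_eq_right_inv hU
  calc ∑ s, U b s * TLam U c k s j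
      = ∑ a, (U * Uᵀ) b a * ∑ p, ∑ q, U p j * U q k * c q a p := by
        simp only [TLam, hinv, Matrix.mul_apply, Matrix.transpose_apply, Finset.mul_sum,
          Finset.sum_mul]
        rw [Finset.sum_comm]
        refine Finset.sum_congr rfl fun a _ => ?_
        rw [Finset.sum_comm]
        refine Finset.sum_congr rfl fun p _ => ?_
        rw [Finset.sum_comm]
        exact Finset.sum_congr rfl fun q _ => Finset.sum_congr rfl fun s _ => by ring
    _ = ∑ p, ∑ q, U p j * U q k * c q b p := by
        simp [hU, Matrix.one_apply]

/-- `R2` with the trace covector `s ↦ Σ_m c m m s` factored out. -/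
theorem R2_eq_sum_trace_mul {n : ℕ} (c : Fin n → Fin n → Fin n → ℝ) (j k : Fin n) :
    R2 c j k = (1/2) * ∑ s, (∑ m, c m m s) * (c k s j + c j s k) := by
  simp only [R2, Finset.sum_mul]

/-- `R²` is equivariant under the orthogonal group:
`R²(T_Λ(U)c) = T_S(U)(R²(c))` for any orthogonal `U`. -/
theorem R2_equivariant_O (n : ℕ) (c : Fin n → Fin n → Fin n → ℝ)
    (hc : ∀ i j k : Fin n, c k i j = - c k j i)
    (U : Matrix (Fin n) (Fin n) ℝ) (hU : Uᵀ * U = 1) (j k : Fin n) :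
    R2 (TLam U c) j k = ∑ p, ∑ q, U p j * U q k * R2 c p q := by
  have hU' : U * Uᵀ = 1 := mul_eq_one_comm.mp hU
  have hinv : U * U⁻¹ = 1 := by rw [Matrix.inv_eq_right_inv hU', hU']
  simp only [R2_eq_sum_trace_mul, sum_TLam_diag c hinv]
  set t : Fin n → ℝ := fun b => ∑ l, c l l b
  calc (1/2) * ∑ s, (∑ b, U b s * t b) * (TLam U c k s j + TLam U c j s k)
      = (1/2) * ∑ b, t b * (∑ s, U b s * TLam U c k s j + ∑ s, U b s * TLam U c j s k) := by
        simp only [← Finset.sum_add_distrib, Finset.mul_sum, Finset.sum_mul]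
        rw [Finset.sum_comm]
        exact Finset.sum_congr rfl fun b _ => Finset.sum_congr rfl fun s _ => by ring
    _ = (1/2) * ∑ b, t b * ∑ p, ∑ q, U p j * U q k * (c q b p + c p b q) := by
        congr 1
        refine Finset.sum_congr rfl fun b _ => ?_
        rw [sum_mul_TLam c hU', sum_mul_TLam c hU', Finset.sum_comm (f := fun p q => U p k * _ * _)]
        simp only [← Finset.sum_add_distrib]
        congr 1
        exact Finset.sum_congr rfl fun p _ => Finset.sum_congr rfl fun q _ => by ring
    _ = ∑ p, ∑ q, U p j * U q k * ((1/2) * ∑ b, t b * (c q b p + c p b q)) := by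
        simp only [Finset.mul_sum]
        rw [Finset.sum_comm]
        refine Finset.sum_congr rfl fun p _ => ?_
        rw [Finset.sum_comm]
        exact Finset.sum_congr rfl fun q _ => Finset.sum_congr rfl fun b _ => by ring
end
end

section
/- Let n ∈ ℕ, let c : Fin n → Fin n → Fin n → ℝ be skew-symmetric in its two lower indices, and let U : Matrix (Fin n) (Fin n) ℝ be orthogonal (Uᵀ * U = 1). Then R³(T_Λ(U)c) = T_S(U)(R³(c)), i.e. for all j, k: R³(T_Λ(U)c) j k = Σ_{p,q} U p j · U q k · R³(c) p q. -/
open Matrix BigOperators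

noncomputable section

theorem R3_eq_trace {n : ℕ} (c : Fin n → Fin n → Fin n → ℝ) (j k : Fin n) :
    R3 c j k = (1/4) * ((of (c j))ᵀ * of (c k)).trace := by
  rw [R3, Finset.sum_comm]
  simp [Matrix.trace, Matrix.mul_apply]

theorem of_TLam_of_orthogonal {n : ℕ} (c : Fin n → Fin n → Fin n → ℝ)
    {U : Matrix (Fin n) (Fin n) ℝ} (hU : Uᵀ * U = 1) (k : Fin n) :
    of (TLam U c k) = ∑ l, U l k • (Uᵀ * of (c l) * U) := by
  ext i j
  simp only [TLam, Matrix.inv_eq_left_inv hU, of_apply, transpose_apply, Matrix.sum_apply,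
    Matrix.smul_apply, Matrix.mul_apply, smul_eq_mul, Finset.mul_sum, Finset.sum_mul]
  rw [Finset.sum_comm]
  simp_rw [Finset.sum_comm (γ := Fin n) (f := fun s l => U s i * U _ j * c l s _ * U l k)]
  rw [Finset.sum_comm]
  refine Finset.sum_congr rfl fun l _ => Finset.sum_congr rfl fun m _ =>
    Finset.sum_congr rfl fun s _ => ?_
  ring

theorem trace_transpose_mul_conj_of_orthogonal {n : ℕ} {U : Matrix (Fin n) (Fin n) ℝ}
    (hU : Uᵀ * U = 1) (A B : Matrix (Fin n) (Fin n) ℝ) :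
    ((Uᵀ * A * U)ᵀ * (Uᵀ * B * U)).trace = (Aᵀ * B).trace := by
  have hU' : U * Uᵀ = 1 := mul_eq_one_comm.mp hU
  calc ((Uᵀ * A * U)ᵀ * (Uᵀ * B * U)).trace
      = (Uᵀ * (Aᵀ * (U * Uᵀ) * B * U)).trace := by
        simp only [transpose_mul, transpose_transpose, Matrix.mul_assoc]
    _ = (Aᵀ * B).trace := by
        rw [Matrix.trace_mul_comm, hU', Matrix.mul_one, Matrix.mul_assoc, hU', Matrix.mul_one]

/-- `R³` is equivariant under the orthogonal group:
`R³(T_Λ(U)c) = T_S(U)(R³(c))` for any orthogonal `U`. -/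
theorem R3_equivariant_O (n : ℕ) (c : Fin n → Fin n → Fin n → ℝ)
    (hc : ∀ i j k : Fin n, c k i j = - c k j i)
    (U : Matrix (Fin n) (Fin n) ℝ) (hU : Uᵀ * U = 1) (j k : Fin n) :
    R3 (TLam U c) j k = ∑ p, ∑ q, U p j * U q k * R3 c p q := by
  simp only [R3_eq_trace, of_TLam_of_orthogonal c hU, transpose_sum, transpose_smul,
    Finset.sum_mul, Finset.mul_sum, Matrix.smul_mul, Matrix.mul_smul, trace_sum, trace_smul,
    trace_transpose_mul_conj_of_orthogonal hU, smul_eq_mul]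
  rw [Finset.sum_comm]
  refine Finset.sum_congr rfl fun p _ => Finset.sum_congr rfl fun q _ => ?_
  ring
end
end

section
/- Let n ∈ ℕ, let c : Fin n → Fin n → Fin n → ℝ be skew-symmetric in its two lower indices, and let U : Matrix (Fin n) (Fin n) ℝ be orthogonal (Uᵀ * U = 1). Then R(T_Λ(U)c) = T_S(U)(R(c)), i.e. for all j, k: R(T_Λ(U)c) j k = Σ_{p,q} U p j · U q k · R(c) p q. -/
open Matrix BigOperators

noncomputable section

section Rotation

variable {n : ℕ} {U : Matrix (Fin n) (Fin n) ℝ}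

/-- The change of basis of a tensor with three indices by the columns of a matrix. -/
def rotate (U : Matrix (Fin n) (Fin n) ℝ) (F : Fin n → Fin n → Fin n → ℝ) (a b j : Fin n) : ℝ :=
  ∑ s, U s a * ∑ t, U t b * ∑ p, U p j * F s t p

theorem rotate_swap (F : Fin n → Fin n → Fin n → ℝ) (a b j : Fin n) :
    rotate U (fun s t p => F t s p) a b j = rotate U F b a j := by
  simp only [rotate, Finset.mul_sum]
  rw [Finset.sum_comm]
  simp only [mul_left_comm]

theorem rotate_cycle (F : Fin n → Fin n → Fin n → ℝ) (a b j : Fin n) :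
    rotate U (fun s t p => F p s t) a b j = rotate U F j a b := by
  simp only [rotate, Finset.mul_sum]
  rw [Finset.sum_comm_cycle]
  refine Finset.sum_congr rfl fun p _ => Finset.sum_congr rfl fun s _ =>
    Finset.sum_congr rfl fun t _ => ?_
  ring

theorem sum_mul_of_orthogonal (hU : Uᵀ * U = 1) (f g : Fin n → ℝ) :
    ∑ a, (∑ s, U s a * f s) * ∑ s, U s a * g s = ∑ s, f s * g s := by
  have h : (Uᵀ *ᵥ f) ⬝ᵥ (Uᵀ *ᵥ g) = f ⬝ᵥ g := by
    rw [Matrix.dotProduct_mulVec, Matrix.vecMul_transpose, Matrix.mulVec_mulVec,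
      mul_eq_one_comm.mp hU, Matrix.one_mulVec]
  exact h

theorem sum_sum_mul_of_orthogonal (hU : Uᵀ * U = 1) (F G : Fin n → Fin n → ℝ) :
    ∑ a, ∑ b, (∑ s, U s a * ∑ t, U t b * F s t) * (∑ s, U s a * ∑ t, U t b * G s t) =
      ∑ s, ∑ t, F s t * G s t := by
  rw [Finset.sum_comm]
  simp only [sum_mul_of_orthogonal hU]
  rw [Finset.sum_comm]
  simp only [sum_mul_of_orthogonal hU]

theorem sum_rotate_mul_rotate (hU : Uᵀ * U = 1) (F G : Fin n → Fin n → Fin n → ℝ) (j k : Fin n) :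
    ∑ a, ∑ b, rotate U F a b j * rotate U G a b k =
      ∑ p, ∑ q, U p j * U q k * ∑ s, ∑ t, F s t p * G s t q := by
  simp only [rotate]
  rw [sum_sum_mul_of_orthogonal hU (fun s t => ∑ p, U p j * F s t p)
    (fun s t => ∑ q, U q k * G s t q)]
  simp only [Finset.sum_mul_sum]
  simp only [Finset.mul_sum]
  calc
    _ = ∑ s, ∑ p, ∑ q, ∑ t, U p j * F s t p * (U q k * G s t q) :=
      Finset.sum_congr rfl fun s _ => Finset.sum_comm_cycle.symm
    _ = ∑ p, ∑ q, ∑ s, ∑ t, U p j * F s t p * (U q k * G s t q) :=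
      Finset.sum_comm_cycle.symm
    _ = _ := by simp only [mul_mul_mul_comm]

theorem TLam_eq_rotate (hU : Uᵀ * U = 1) (c : Fin n → Fin n → Fin n → ℝ) (k i j : Fin n) :
    TLam U c k i j = rotate U c k i j := by
  rw [← rotate_cycle]
  simp only [TLam, rotate, Matrix.inv_eq_left_inv hU, Matrix.transpose_apply, Finset.mul_sum]
  refine Finset.sum_congr rfl fun s _ => Finset.sum_congr rfl fun m _ =>
    Finset.sum_congr rfl fun l _ => ?_
  ring

theorem sum_rotate_diag (hU : Uᵀ * U = 1) (F : Fin n → Fin n → Fin n → ℝ) (j : Fin n) :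
    ∑ a, rotate U F a a j = ∑ p, U p j * ∑ s, F s s p := by
  have h (g : Fin n → ℝ) (s : Fin n) : ∑ a, U s a * ∑ t, U t a * g t = g s := by
    have : U *ᵥ (Uᵀ *ᵥ g) = g := by
      rw [Matrix.mulVec_mulVec, mul_eq_one_comm.mp hU, Matrix.one_mulVec]
    exact congrFun this s
  simp only [rotate]
  rw [Finset.sum_comm]
  simp only [h]
  simp only [Finset.mul_sum]
  exact Finset.sum_comm

theorem R1_TLam (hU : Uᵀ * U = 1) (c : Fin n → Fin n → Fin n → ℝ) (j k : Fin n) :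
    R1 (TLam U c) j k = ∑ p, ∑ q, U p j * U q k * R1 c p q := by
  simp only [R1, TLam_eq_rotate hU, mul_left_comm _ (-(1 / 2) : ℝ), ← Finset.mul_sum]
  rw [← sum_rotate_mul_rotate hU c (fun s m q => c m s q)]
  simp only [rotate_swap]

theorem R2_TLam (hU : Uᵀ * U = 1) (c : Fin n → Fin n → Fin n → ℝ) (j k : Fin n) :
    R2 (TLam U c) j k = ∑ p, ∑ q, U p j * U q k * R2 c p q := by
  have h (j k : Fin n) :
      ∑ s, (∑ m, rotate U c m m s) * rotate U c k s j =
        ∑ p, ∑ q, U p j * U q k * ∑ s, (∑ m, c m m s) * c q s p := by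
    simp only [sum_rotate_diag hU, ← rotate_swap c]
    simp only [rotate]
    rw [sum_mul_of_orthogonal hU (fun s => ∑ m, c m m s)
      (fun s => ∑ q, U q k * ∑ p, U p j * c q s p)]
    simp only [Finset.mul_sum]
    rw [← Finset.sum_comm_cycle, Finset.sum_comm]
    refine Finset.sum_congr rfl fun p _ => Finset.sum_congr rfl fun q _ =>
      Finset.sum_congr rfl fun s _ => ?_
    ring
  have h' : ∑ p, ∑ q, U p k * U q j * ∑ s, (∑ m, c m m s) * c q s p =
      ∑ p, ∑ q, U p j * U q k * ∑ s, (∑ m, c m m s) * c p s q := by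
    rw [Finset.sum_comm]
    simp only [mul_comm (U _ k)]
  simp only [R2, TLam_eq_rotate hU, mul_left_comm _ (1 / 2 : ℝ), ← Finset.mul_sum,
    ← Finset.sum_mul, mul_add, Finset.sum_add_distrib]
  rw [h j k, h k j, h']

theorem R3_TLam (hU : Uᵀ * U = 1) (c : Fin n → Fin n → Fin n → ℝ) (j k : Fin n) :
    R3 (TLam U c) j k = ∑ p, ∑ q, U p j * U q k * R3 c p q := by
  simp only [R3, TLam_eq_rotate hU, mul_left_comm _ (1 / 4 : ℝ), ← Finset.mul_sum]
  rw [← sum_rotate_mul_rotate hU (fun s m p => c p s m) (fun s m q => c q s m)]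
  simp only [rotate_cycle]

theorem R4_TLam (hU : Uᵀ * U = 1) (c : Fin n → Fin n → Fin n → ℝ) (j k : Fin n) :
    R4 (TLam U c) j k = ∑ p, ∑ q, U p j * U q k * R4 c p q := by
  simp only [R4, TLam_eq_rotate hU, mul_left_comm _ (-(1 / 2) : ℝ), ← Finset.mul_sum]
  rw [← sum_rotate_mul_rotate hU (fun s m p => c m s p) (fun s m q => c m s q)]
  simp only [rotate_swap]

end Rotation

/-- The full Ricci matrix `R = R¹ + R² + R³ + R⁴` is equivariant under the
orthogonal group: `R(T_Λ(U)c) = T_S(U)(R(c))` for any orthogonal `U`. -/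
theorem Ricci_equivariant_O (n : ℕ) (c : Fin n → Fin n → Fin n → ℝ)
    (hc : ∀ i j k : Fin n, c k i j = - c k j i)
    (U : Matrix (Fin n) (Fin n) ℝ) (hU : Uᵀ * U = 1) (j k : Fin n) :
    Rtot (TLam U c) j k = ∑ p, ∑ q, U p j * U q k * Rtot c p q := by
  simp only [Rtot, Matrix.of_apply, R1_TLam hU, R2_TLam hU, R3_TLam hU, R4_TLam hU, mul_add,
    Finset.sum_add_distrib]
end
end

section
/- Let n ∈ ℕ and let Q : ℝ → Matrix (Fin n) (Fin n) ℝ be a smooth (C^∞) curve such that Q(t) is invertible for every t. Then there exist smooth curves B, U : ℝ → Matrix (Fin n) (Fin n) ℝ such that for every t: B(t) is upper triangular with positive diagonal entries (hence invertible), U(t) is orthogonal (U(t)ᵀ * U(t) = 1), and Q(t) = B(t) * U(t). -/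
open Matrix

section GramSchmidtSmooth

variable {ι E F : Type*} [LinearOrder ι] [LocallyFiniteOrderBot ι] [WellFoundedLT ι]
  [NormedAddCommGroup E] [InnerProductSpace ℝ E] [NormedAddCommGroup F] [NormedSpace ℝ F]

open InnerProductSpace

/-- The Gram-Schmidt process depends smoothly on a linearly independent family. -/
theorem contDiff_gramSchmidt {k : WithTop ℕ∞} {f : F → ι → E}
    (hf : ∀ i, ContDiff ℝ k fun t => f t i) (hli : ∀ t, LinearIndependent ℝ (f t)) (i : ι) :
    ContDiff ℝ k fun t => gramSchmidt ℝ (f t) i := by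
  induction i using WellFoundedLT.induction with
  | ind i ih =>
    have hdef : (fun t => gramSchmidt ℝ (f t) i) = fun t => f t i - ∑ j ∈ Finset.Iio i,
        (inner ℝ (gramSchmidt ℝ (f t) j) (f t i) / ‖gramSchmidt ℝ (f t) j‖ ^ 2) •
          gramSchmidt ℝ (f t) j := by
      funext t
      rw [gramSchmidt_def]
      simp only [Submodule.starProjection_singleton, RCLike.ofReal_real_eq_id, id_eq]
    rw [hdef]
    refine (hf i).sub (ContDiff.sum fun j hj => ?_)
    have hg := ih j (Finset.mem_Iio.mp hj)
    refine ContDiff.smul (ContDiff.div (hg.inner ℝ (hf i)) ?_ fun t => ?_) hg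
    · exact hg.norm_sq ℝ
    · simpa using gramSchmidt_ne_zero j (hli t)

/-- The normalized Gram-Schmidt process depends smoothly on a linearly independent family. -/
theorem contDiff_gramSchmidtNormed {k : WithTop ℕ∞} {f : F → ι → E}
    (hf : ∀ i, ContDiff ℝ k fun t => f t i) (hli : ∀ t, LinearIndependent ℝ (f t)) (i : ι) :
    ContDiff ℝ k fun t => gramSchmidtNormed ℝ (f t) i := by
  have hg := contDiff_gramSchmidt hf hli i
  have h0 : ∀ t, gramSchmidt ℝ (f t) i ≠ 0 := fun t => gramSchmidt_ne_zero i (hli t)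
  exact ((hg.norm ℝ h0).inv fun t => norm_ne_zero_iff.mpr (h0 t)).smul hg

theorem inner_gramSchmidt_self (f : ι → E) (i : ι) :
    inner ℝ (gramSchmidt ℝ f i) (f i) = ‖gramSchmidt ℝ f i‖ ^ 2 := by
  conv_lhs => rw [gramSchmidt_def'' ℝ f i]
  rw [inner_add_right, inner_sum, real_inner_self_eq_norm_sq, Finset.sum_eq_zero, add_zero]
  intro j hj
  rw [inner_smul_right, gramSchmidt_orthogonal ℝ f (Finset.mem_Iio.mp hj).ne', mul_zero]

theorem inner_gramSchmidtNormed_self_pos {f : ι → E} (hli : LinearIndependent ℝ f) (i : ι) :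
    0 < inner ℝ (gramSchmidtNormed ℝ f i) (f i) := by
  have h0 := norm_pos_iff.mpr (gramSchmidt_ne_zero i hli)
  rw [gramSchmidtNormed, real_inner_smul_left, inner_gramSchmidt_self]
  simp only [RCLike.ofReal_real_eq_id, id_eq]
  positivity

end GramSchmidtSmooth

/-- Smooth QR-type decomposition. A smooth curve of invertible matrices
`Q(t)` decomposes as `Q(t) = B(t) * U(t)` with `B(t)` smooth, upper triangular with
positive diagonal entries, and `U(t)` smooth orthogonal. -/
theorem smooth_QR_decomposition (n : ℕ) (Q : ℝ → Matrix (Fin n) (Fin n) ℝ)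
    (hQsmooth : ∀ i j, ContDiff ℝ (⊤ : ℕ∞) (fun t => Q t i j))
    (hQinv : ∀ t, IsUnit (Q t).det) :
    ∃ B U : ℝ → Matrix (Fin n) (Fin n) ℝ,
      (∀ i j, ContDiff ℝ (⊤ : ℕ∞) (fun t => B t i j)) ∧
      (∀ i j, ContDiff ℝ (⊤ : ℕ∞) (fun t => U t i j)) ∧
      (∀ t, ∀ i j : Fin n, j < i → B t i j = 0) ∧
      (∀ t, ∀ i : Fin n, 0 < B t i i) ∧
      (∀ t, (U t)ᵀ * U t = 1) ∧
      (∀ t, Q t = B t * U t) := by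
  -- Upper triangularity of `B` requires orthonormalizing the rows from the last one upwards.
  let f : ℝ → Fin n → EuclideanSpace ℝ (Fin n) := fun t i => WithLp.toLp 2 (Q t i.rev)
  let e : ℝ → Fin n → EuclideanSpace ℝ (Fin n) := fun t =>
    InnerProductSpace.gramSchmidtNormed ℝ (f t)
  have hf : ∀ i, ContDiff ℝ (⊤ : ℕ∞) fun t => f t i := fun i =>
    contDiff_euclidean.mpr fun j => hQsmooth i.rev j
  have hli : ∀ t, LinearIndependent ℝ (f t) := fun t => by
    have h := Matrix.linearIndependent_rows_of_isUnit
      ((Matrix.isUnit_iff_isUnit_det (Q t)).mpr (hQinv t))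
    exact (h.comp Fin.rev Fin.rev_injective).map'
      (WithLp.linearEquiv 2 ℝ (Fin n → ℝ)).symm.toLinearMap (LinearEquiv.ker _)
  have he : ∀ i, ContDiff ℝ (⊤ : ℕ∞) fun t => e t i := contDiff_gramSchmidtNormed hf hli
  let U : ℝ → Matrix (Fin n) (Fin n) ℝ := fun t => Matrix.of fun i j => e t i.rev j
  have hU : ∀ i j, ContDiff ℝ (⊤ : ℕ∞) fun t => U t i j := fun i j =>
    contDiff_euclidean.mp (he i.rev) j
  have hB : ∀ t i j, (Q t * (U t)ᵀ) i j = inner ℝ (e t j.rev) (f t i.rev) := fun t i j => by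
    simp [Matrix.mul_apply, U, f, PiLp.inner_apply]
  have hUU : ∀ t, (U t)ᵀ * U t = 1 := fun t => by
    rw [mul_eq_one_comm]
    ext i j
    have h := orthonormal_iff_ite.mp
      (InnerProductSpace.gramSchmidtNormed_orthonormal (𝕜 := ℝ) (hli t)) j.rev i.rev
    simp only [Fin.rev_inj, PiLp.inner_apply] at h
    simpa [Matrix.mul_apply, U, e, Matrix.one_apply, eq_comm] using h
  refine ⟨fun t => Q t * (U t)ᵀ, U, fun i j => ?_, hU, fun t i j hij => ?_, fun t i => ?_, hUU,
    fun t => ?_⟩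
  · simp only [hB]
    exact (he j.rev).inner ℝ (hf i.rev)
  · refine (hB t i j).trans ?_
    simp only [e, InnerProductSpace.gramSchmidtNormed]
    rw [real_inner_smul_left, InnerProductSpace.gramSchmidt_inv_triangular ℝ (f t)
      (Fin.rev_lt_rev.mpr hij), mul_zero]
  · exact (inner_gramSchmidtNormed_self_pos (hli t) i.rev).trans_eq (hB t i i).symm
  · rw [Matrix.mul_assoc, hUU, Matrix.mul_one]
end

section
/- Let c : Fin 3 → Fin 3 → Fin 3 → ℝ be skew-symmetric in its two lower indices (c k i j = − c k j i) and satisfy the unimodularity condition Σ_s c s s k = 0 for every k. Then c satisfies the Jacobi identity: for all i, j, k, l, Σ_m ( c l m k · c m i j + c l m i · c m j k + c l m j · c m k i ) = 0. -/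
open BigOperators

/-- In dimension three, skew-symmetry in the lower indices together with
the unimodularity (trace) condition implies the Jacobi identity. -/
theorem unimodular_implies_jacobi (c : Fin 3 → Fin 3 → Fin 3 → ℝ)
    (hc : ∀ i j k : Fin 3, c k i j = - c k j i)
    (htrace : ∀ k : Fin 3, ∑ s, c s s k = 0) :
    ∀ i j k l : Fin 3,
      ∑ m, (c l m k * c m i j + c l m i * c m j k + c l m j * c m k i) = 0 := by
  have hdiag (k i : Fin 3) : c k i i = 0 := by linarith [hc i i k]
  have h10 (k : Fin 3) : c k 1 0 = -c k 0 1 := hc 1 0 k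
  have h20 (k : Fin 3) : c k 2 0 = -c k 0 2 := hc 2 0 k
  have h21 (k : Fin 3) : c k 2 1 = -c k 1 2 := hc 2 1 k
  have htr0 := htrace 0
  have htr1 := htrace 1
  have htr2 := htrace 2
  simp only [Fin.sum_univ_three, hdiag, h10, h20, h21] at htr0 htr1 htr2
  have h202 : c 2 0 2 = -c 1 0 1 := by linarith
  have h212 : c 2 1 2 = c 0 0 1 := by linarith
  have h112 : c 1 1 2 = -c 0 0 2 := by linarith
  intro i j k l
  fin_cases i <;> fin_cases j <;> fin_cases k <;> fin_cases l <;>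
    simp only [Fin.sum_univ_three, Fin.zero_eta, Fin.mk_one, Fin.reduceFinMk, hdiag, h10, h20,
      h21, h202, h212, h112] <;>
    ring
end
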